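/- Under the correlated Gaussian model with parameter ε > 0, let λ_n satisfy 0 < λ_n ≤ D√n for a fixed D > 0, and set Y_n = X_n + (λ_n/√n)·𝟙𝟙ᵀ. Then λ₁(Y_n) − λ_n√n = O_P(√n), i.e. for every δ > 0 there exist M > 0 and n₀ such that P(|λ₁(Y_n) − λ_n√n| > M√n) ≤ δ for all n ≥ n₀. -/

import Mathlib

open MeasureTheory ProbabilityTheory Filter Topology

noncomputable section

/-- The largest eigenvalue of a real symmetric matrix, realised as the supremum of its set
of real eigenvalues. -/
def lam1 {n : ℕ} (A : Matrix (Fin n) (Fin n) ℝ) : ℝ :=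
  sSup {t : ℝ | ∃ v : Fin n → ℝ, v ≠ 0 ∧ A.mulVec v = t • v}

/-- A finite family of real random variables is a centered (jointly) Gaussian vector:
every linear combination of the coordinates has a centered Gaussian law. -/
def IsCenteredGaussianVec {Ω : Type*} [MeasureSpace Ω] {ι : Type*} [Fintype ι]
    (X : ι → Ω → ℝ) : Prop :=
  (∀ i, Measurable (X i)) ∧
    ∀ c : ι → ℝ, ∃ v : NNReal,
      Measure.map (fun ω => ∑ i, c i * X i ω) (volume : Measure Ω) = gaussianReal 0 v

/-- Covariance of two real random variables. -/
def pcov {Ω : Type*} [MeasureSpace Ω] (W V : Ω → ℝ) : ℝ :=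
  (∫ ω, W ω * V ω) - (∫ ω, W ω) * ∫ ω, V ω

/-- Variance of a real random variable. -/
def pvar {Ω : Type*} [MeasureSpace Ω] (W : Ω → ℝ) : ℝ := pcov W W

/-- The correlated Gaussian model with parameter `ε` and constant `C`: for each `n`,
`X n` is a random symmetric `n × n` matrix whose entries `(X_{ij})_{i ≤ j}` form a centered
Gaussian vector with unit variances and pairwise correlations bounded by `C * n ^ (-(1+ε))`. -/
structure CorrGaussian (Ω : Type*) [MeasureSpace Ω]
    (X : (n : ℕ) → Ω → Matrix (Fin n) (Fin n) ℝ) (C ε : ℝ) : Prop where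
  symm : ∀ n ω, (X n ω).IsSymm
  gauss : ∀ n, IsCenteredGaussianVec fun p : Fin n × Fin n => fun ω => X n ω p.1 p.2
  var_one : ∀ n, ∀ i j : Fin n, ∫ ω, (X n ω i j) ^ 2 = 1
  corr_le : ∀ n, ∀ i j i' j' : Fin n, ¬((i, j) = (i', j') ∨ (i, j) = (j', i')) →
    |∫ ω, X n ω i j * X n ω i' j'| ≤ C * (n : ℝ) ^ (-(1 + ε))

/-- The all-ones `n × n` matrix `𝟙𝟙ᵀ`. -/
def onesMat (n : ℕ) : Matrix (Fin n) (Fin n) ℝ := Matrix.of fun _ _ => 1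

/-- The operator (spectral) norm of a real matrix, i.e. the norm of the induced map on
Euclidean space. -/
def opNorm {n : ℕ} (A : Matrix (Fin n) (Fin n) ℝ) : ℝ :=
  ‖(Matrix.toEuclideanLin A).toContinuousLinearMap‖

/-- `T n = O_P(a n)`: for every `δ > 0` there are `M > 0` and `n₀` such that
`P(|T n| > M * a n) ≤ δ` for all `n ≥ n₀`. -/
def IsBigOP {Ω : Type*} [MeasureSpace Ω] (T : ℕ → Ω → ℝ) (a : ℕ → ℝ) : Prop :=
  ∀ δ : ℝ, 0 < δ → ∃ M : ℝ, 0 < M ∧ ∃ n₀ : ℕ, ∀ n ≥ n₀,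
    (volume {ω | M * a n < |T n ω|}).toReal ≤ δ

/-- The sparse Rademacher(p) law `p δ_{-1} + (1 - 2p) δ_0 + p δ_1`. -/
def sparseRademacher (p : ℝ) : Measure ℝ :=
  ENNReal.ofReal p • Measure.dirac (-1) + ENNReal.ofReal (1 - 2 * p) • Measure.dirac 0 +
    ENNReal.ofReal p • Measure.dirac 1

end


noncomputable def gm (m : ℕ) : ℝ := ∫ x, x ^ m ∂(gaussianReal 0 1)

lemma gm_scale (v : NNReal) (m : ℕ) :
    ∫ x, x ^ (2 * m) ∂(gaussianReal 0 v) = gm (2 * m) * (v : ℝ) ^ m := by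
  have h : (gaussianReal 0 1).map (fun x => (Real.sqrt v) * x) = gaussianReal 0 v := by
    rw [gaussianReal_map_const_mul]
    congr 1
    · simp
    · ext; simp
  rw [← h, integral_map (by fun_prop) (by fun_prop), gm, ← integral_mul_const]
  congr 1; ext x
  rw [mul_pow, pow_mul, Real.sq_sqrt v.coe_nonneg, mul_comm]

lemma integrable_pow_gaussian (v : NNReal) (m : ℕ) :
    Integrable (fun x : ℝ => x ^ m) (gaussianReal 0 v) := by
  have := (memLp_id_gaussianReal' (μ := 0) (v := v) (m : ENNReal) (by simp)).integrable_norm_pow'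
  refine this.mono' (by fun_prop) ?_
  filter_upwards with x
  simp

lemma gm_one : gm (2 * 1) = 1 := by
  have h := variance_fun_id_gaussianReal (μ := 0) (v := 1)
  rw [variance_eq_integral (by fun_prop)] at h
  simpa [gm] using h

lemma gm_nonneg (m : ℕ) : 0 ≤ gm (2 * m) :=
  integral_nonneg fun x => by simp only [pow_mul]; positivity

lemma gm_bound (m : ℕ) : gm (2 * m) ≤ (12 * m) ^ m := by
  rcases Nat.eq_zero_or_pos m with rfl | hm
  · simp [gm]
  have hm' : (0:ℝ) < m := by exact_mod_cast hm
  set s : ℝ := Real.sqrt (2 * m) with hs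
  have hs2 : s ^ 2 = 2 * m := Real.sq_sqrt (by positivity)
  have hexp : ∀ t : ℝ, ∫ x, Real.exp (t * x) ∂(gaussianReal 0 1) = Real.exp (t ^ 2 / 2) := by
    intro t
    have := congrFun (mgf_id_gaussianReal (μ := 0) (v := 1)) t
    simpa [mgf] using this
  have key : ∫ x, (s ^ (2 * m)) * x ^ (2 * m) ∂(gaussianReal 0 1) ≤
      ∫ x, ((2 * m).factorial : ℝ) * (Real.exp (s * x) + Real.exp ((-s) * x))
        ∂(gaussianReal 0 1) := by
    apply integral_mono ((integrable_pow_gaussian 1 _).const_mul _)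
    · exact ((integrable_exp_mul_gaussianReal s).add
        (integrable_exp_mul_gaussianReal (-s))).const_mul _
    · intro x
      have h1 := Real.pow_div_factorial_le_exp |s * x| (abs_nonneg _) (2 * m)
      rw [div_le_iff₀ (by positivity)] at h1
      have h2 : |s * x| ^ (2 * m) = s ^ (2 * m) * x ^ (2 * m) := by
        rw [pow_mul, sq_abs, ← pow_mul, mul_pow]
      have h3 : Real.exp |s * x| ≤ Real.exp (s * x) + Real.exp (-s * x) := by
        rcases abs_cases (s * x) with ⟨h, _⟩ | ⟨h, _⟩ <;> rw [h]
        · linarith [Real.exp_pos (-s * x)]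
        · rw [neg_mul]; linarith [Real.exp_pos (s * x)]
      simp only
      rw [← h2]
      nlinarith [(by positivity : (0:ℝ) < (2 * m).factorial)]
  rw [integral_const_mul, integral_const_mul, integral_add
    (integrable_exp_mul_gaussianReal s) (integrable_exp_mul_gaussianReal (-s)), hexp, hexp,
    neg_sq, hs2] at key
  have hf : ((2 * m).factorial : ℝ) ≤ (2 * m : ℝ) ^ (2 * m) := by
    exact_mod_cast Nat.factorial_le_pow (2 * m)
  have e1 : Real.exp (2 * m / 2) ≤ 3 ^ m := by
    have : (2 * m / 2 : ℝ) = m * 1 := by ring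
    rw [this, Real.exp_nat_mul]
    gcongr
    linarith [Real.exp_one_lt_d9]
  have hspow : s ^ (2 * m) = (2 * m : ℝ) ^ m := by rw [pow_mul, hs2]
  change s ^ (2 * m) * gm (2 * m) ≤ _ at key
  rw [hspow] at key
  have h2m : (2:ℝ) ≤ 2 ^ m := by
    calc (2:ℝ) = 2 ^ 1 := by norm_num
      _ ≤ 2 ^ m := pow_le_pow_right₀ (by norm_num) hm
  have : (2 * m : ℝ) ^ m * gm (2 * m) ≤ (2 * m : ℝ) ^ m * ((12 * m) ^ m) := by
    refine key.trans ?_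
    calc ((2 * m).factorial : ℝ) * (Real.exp (2 * m / 2) + Real.exp (2 * m / 2))
        ≤ (2 * m : ℝ) ^ (2 * m) * (2 ^ m * 3 ^ m) := by
          gcongr
          nlinarith [Real.exp_pos (2 * m / 2 : ℝ)]
      _ = _ := by
        rw [two_mul m, pow_add, mul_assoc, ← mul_pow, ← mul_pow]
        congr 2
        ring
  exact le_of_mul_le_mul_left this (by positivity)

open MvPolynomial in
lemma coeff_identity {ι : Type*} [Fintype ι] [DecidableEq ι] (m : ℕ) (c : ℝ)
    (A : (Fin (2 * m) → ι) → ℝ) (K : ι → ι → ℝ)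
    (hA : ∀ t : ι → ℝ, ∑ f : Fin (2 * m) → ι, A f * ∏ i, t (f i) =
      c * (∑ p : ι × ι, K p.1 p.2 * (t p.1 * t p.2)) ^ m) (α : ι →₀ ℕ) :
    ∑ f : Fin (2 * m) → ι, (if ∑ i, Finsupp.single (f i) 1 = α then A f else 0) =
      c * ∑ g : Fin m → ι × ι,
        (if ∑ i, (Finsupp.single (g i).1 1 + Finsupp.single (g i).2 1) = α
          then ∏ i, K (g i).1 (g i).2 else 0) := by
  have hpoly : (∑ f : Fin (2 * m) → ι, monomial (∑ i, Finsupp.single (f i) 1) (A f)) =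
      C c * ∑ g : Fin m → ι × ι,
        monomial (∑ i, (Finsupp.single (g i).1 1 + Finsupp.single (g i).2 1))
          (∏ i, K (g i).1 (g i).2) := by
    apply MvPolynomial.funext
    intro t
    have h1 : ∀ α β : ι →₀ ℕ, (α + β).prod (fun i k => t i ^ k) =
        α.prod (fun i k => t i ^ k) * β.prod (fun i k => t i ^ k) := fun α β =>
      Finsupp.prod_add_index' (by simp) (fun _ _ _ => pow_add _ _ _)
    have h2 : ∀ {N : ℕ} (α : Fin N → ι →₀ ℕ), (∑ i, α i).prod (fun i k => t i ^ k) =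
        ∏ i, (α i).prod (fun i k => t i ^ k) := by
      intro N α
      exact (Finsupp.prod_finsetSum_index (by simp) (fun _ _ _ => pow_add _ _ _)).symm
    have h3 : ∀ a : ι, (Finsupp.single a 1).prod (fun i k => t i ^ k) = t a := by
      intro a; simp
    simp only [map_sum, map_mul, eval_monomial, eval_C, h2, h1, h3]
    rw [hA t, Fintype.sum_pow]
    simp only [Finset.prod_mul_distrib]
  have := congrArg (coeff α) hpoly
  simpa [coeff_sum, coeff_C_mul, coeff_monomial] using this

lemma moment_compare {ι : Type*} [Fintype ι] [DecidableEq ι] (m : ℕ) (c : ℝ) (hc : 0 ≤ c)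
    (A B : (Fin (2 * m) → ι) → ℝ) (K L : ι → ι → ℝ)
    (hA : ∀ t : ι → ℝ, ∑ f : Fin (2 * m) → ι, A f * ∏ i, t (f i) =
      c * (∑ p : ι × ι, K p.1 p.2 * (t p.1 * t p.2)) ^ m)
    (hB : ∀ t : ι → ℝ, ∑ f : Fin (2 * m) → ι, B f * ∏ i, t (f i) =
      c * (∑ p : ι × ι, L p.1 p.2 * (t p.1 * t p.2)) ^ m)
    (hAs : ∀ f g : Fin (2 * m) → ι,
      ∑ i, Finsupp.single (f i) 1 = ∑ i, Finsupp.single (g i) 1 → A f = A g)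
    (hBs : ∀ f g : Fin (2 * m) → ι,
      ∑ i, Finsupp.single (f i) 1 = ∑ i, Finsupp.single (g i) 1 → B f = B g)
    (hKL : ∀ a b, |K a b| ≤ L a b) (f : Fin (2 * m) → ι) : A f ≤ B f := by
  set α : ι →₀ ℕ := ∑ i, Finsupp.single (f i) 1 with hα
  have h1 := coeff_identity m c A K hA α
  have h2 := coeff_identity m c B L hB α
  have hs : ∀ (D : (Fin (2 * m) → ι) → ℝ) (hD : ∀ f g : Fin (2 * m) → ι,
      ∑ i, Finsupp.single (f i) 1 = ∑ i, Finsupp.single (g i) 1 → D f = D g),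
      ∑ g : Fin (2 * m) → ι, (if ∑ i, Finsupp.single (g i) 1 = α then D g else 0) =
      (∑ g : Fin (2 * m) → ι, (if ∑ i, Finsupp.single (g i) 1 = α then (1:ℝ) else 0)) * D f := by
    intro D hD
    rw [Finset.sum_mul]
    apply Finset.sum_congr rfl
    intro g _
    split_ifs with h
    · rw [one_mul]; exact hD _ _ h
    · simp
  rw [hs A hAs] at h1
  rw [hs B hBs] at h2
  have hN : (0:ℝ) < ∑ g : Fin (2 * m) → ι,
      (if ∑ i, Finsupp.single (g i) 1 = α then (1:ℝ) else 0) := by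
    apply Finset.sum_pos'
    · intro g _; split_ifs <;> norm_num
    · exact ⟨f, Finset.mem_univ _, by simp [hα]⟩
  refine le_of_mul_le_mul_left ?_ hN
  rw [h1, h2]
  refine mul_le_mul_of_nonneg_left ?_ hc
  apply Finset.sum_le_sum
  intro g _
  split_ifs
  · calc ∏ i, K (g i).1 (g i).2 ≤ |∏ i, K (g i).1 (g i).2| := le_abs_self _
      _ = ∏ i, |K (g i).1 (g i).2| := Finset.abs_prod _ _
      _ ≤ _ := Finset.prod_le_prod (fun _ _ => abs_nonneg _) (fun _ _ => hKL _ _)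
  · exact le_rfl

/-- All moments of a jointly Gaussian family. -/
lemma trace_paths (n : ℕ) (N : ℕ) : ∀ i j : Fin n, ∃ (s : Type) (_ : Fintype s)
    (φ : s → Fin N → Fin n × Fin n), ∀ A : Matrix (Fin n) (Fin n) ℝ,
      (A ^ N) i j = ∑ x, ∏ l, A (φ x l).1 (φ x l).2 := by
  induction N with
  | zero =>
    intro i j
    by_cases h : i = j
    · exact ⟨Unit, inferInstance, fun _ l => l.elim0, fun A => by simp [h]⟩
    · exact ⟨Empty, inferInstance, fun e => e.elim, fun A => by simp [h]⟩
  | succ N ih =>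
    intro i j
    choose s hs φ hφ using ih
    refine ⟨Σ k : Fin n, s i k, inferInstance,
      fun x => Fin.snoc (α := fun _ => Fin n × Fin n) (φ i x.1 x.2) (x.1, j), fun A => ?_⟩
    rw [pow_succ, Matrix.mul_apply, Fintype.sum_sigma]
    apply Finset.sum_congr rfl
    intro k _
    rw [hφ, Finset.sum_mul]
    apply Finset.sum_congr rfl
    intro x _
    rw [Fin.prod_univ_castSucc]
    simp

structure GaussFam {Ω ι : Type*} [MeasurableSpace Ω] [Fintype ι] (μ : Measure Ω)
    (X : ι → Ω → ℝ) : Prop where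
  meas : ∀ i, Measurable (X i)
  law : ∀ c : ι → ℝ, ∃ v : NNReal, μ.map (fun ω => ∑ i, c i * X i ω) = gaussianReal 0 v

lemma GaussFam.memLp {Ω ι : Type*} [MeasurableSpace Ω] [Fintype ι] [DecidableEq ι]
    {μ : Measure Ω} {X : ι → Ω → ℝ} (h : GaussFam μ X) (a : ι) (p : ENNReal) (hp : p ≠ ⊤) :
    MemLp (X a) p μ := by
  obtain ⟨v, hv⟩ := h.law (Pi.single a 1)
  have e : (fun ω => ∑ i, (Pi.single a 1 : ι → ℝ) i * X i ω) = X a := by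
    ext ω; simp [Pi.single_apply]
  rw [e] at hv
  have h1 := memLp_id_gaussianReal' (μ := 0) (v := v) p hp
  rw [← hv] at h1
  exact (memLp_map_measure_iff (by fun_prop) (h.meas a).aemeasurable).1 h1

lemma GaussFam.integrable_prod {Ω ι : Type*} [MeasurableSpace Ω] [Fintype ι] [DecidableEq ι]
    {μ : Measure Ω} [IsProbabilityMeasure μ] {X : ι → Ω → ℝ} (h : GaussFam μ X)
    {N : ℕ} (f : Fin N → ι) : Integrable (fun ω => ∏ i, X (f i) ω) μ := by
  have := MemLp.prod' (μ := μ) (s := Finset.univ) (f := fun i : Fin N => X (f i))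
    (p := fun _ => (N : ENNReal)) (fun i _ => h.memLp (f i) N (by simp))
  rcases Nat.eq_zero_or_pos N with rfl | hN
  · simp
  have hs : (∑ i : Fin N, (N : ENNReal)⁻¹)⁻¹ = 1 := by
    simp
    rw [ENNReal.mul_inv_cancel (by exact_mod_cast hN.ne') (by simp)]
  rw [hs] at this
  exact memLp_one_iff_integrable.1 this

lemma GaussFam.expand {Ω ι : Type*} [MeasurableSpace Ω] [Fintype ι] [DecidableEq ι]
    {μ : Measure Ω} [IsProbabilityMeasure μ] {X : ι → Ω → ℝ} (h : GaussFam μ X) (N : ℕ)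
    (t : ι → ℝ) : ∫ ω, (∑ i, t i * X i ω) ^ N ∂μ =
      ∑ f : Fin N → ι, (∫ ω, ∏ i, X (f i) ω ∂μ) * ∏ i, t (f i) := by
  simp_rw [Fintype.sum_pow, Finset.prod_mul_distrib]
  rw [integral_finsetSum _ (fun f _ => (h.integrable_prod f).const_mul _)]
  apply Finset.sum_congr rfl
  intro f _
  rw [integral_const_mul, mul_comm]

lemma GaussFam.moments {Ω ι : Type*} [MeasurableSpace Ω] [Fintype ι] [DecidableEq ι]
    {μ : Measure Ω} [IsProbabilityMeasure μ] {X : ι → Ω → ℝ} (h : GaussFam μ X) (m : ℕ)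
    (t : ι → ℝ) : ∫ ω, (∑ i, t i * X i ω) ^ (2 * m) ∂μ =
      gm (2 * m) * (∑ p : ι × ι, (∫ ω, X p.1 ω * X p.2 ω ∂μ) * (t p.1 * t p.2)) ^ m := by
  obtain ⟨v, hv⟩ := h.law t
  have hm : Measurable (fun ω => ∑ i, t i * X i ω) :=
    Finset.measurable_sum _ fun i _ => (h.meas i).const_mul _
  have key : ∀ m : ℕ, ∫ ω, (∑ i, t i * X i ω) ^ (2 * m) ∂μ = gm (2 * m) * (v : ℝ) ^ m := by
    intro m
    rw [← gm_scale, ← hv, integral_map hm.aemeasurable (by fun_prop)]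
  rw [key m]
  congr 2
  have h1 := key 1
  rw [gm_one, one_mul, pow_one] at h1
  rw [← h1, mul_one, h.expand 2 t, ← (finTwoArrowEquiv ι).symm.sum_comp]
  simp [finTwoArrowEquiv]

lemma GaussFam.compare {Ω Ω' : Type*} [MeasurableSpace Ω] [MeasurableSpace Ω']
    {ι : Type*} [Fintype ι] [DecidableEq ι]
    {μ : Measure Ω} [IsProbabilityMeasure μ] {X : ι → Ω → ℝ} (h : GaussFam μ X)
    {ν : Measure Ω'} [IsProbabilityMeasure ν] {Y : ι → Ω' → ℝ} (h' : GaussFam ν Y)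
    (hcov : ∀ a b, |∫ ω, X a ω * X b ω ∂μ| ≤ ∫ ω, Y a ω * Y b ω ∂ν) (m : ℕ)
    (f : Fin (2 * m) → ι) :
    ∫ ω, ∏ i, X (f i) ω ∂μ ≤ ∫ ω, ∏ i, Y (f i) ω ∂ν := by
  have hsym : ∀ (x : ι → ℝ) (f g : Fin (2 * m) → ι),
      ∑ i, Finsupp.single (f i) 1 = ∑ i, Finsupp.single (g i) 1 →
      ∏ i, x (f i) = ∏ i, x (g i) := by
    intro x f g hfg
    have h2 : ∀ f : Fin (2 * m) → ι,
        (∑ i, Finsupp.single (f i) 1).prod (fun i k => x i ^ k) = ∏ i, x (f i) := by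
      intro f
      rw [← Finsupp.prod_finsetSum_index (by simp) (fun _ _ _ => pow_add _ _ _)]
      simp
    rw [← h2, ← h2, hfg]
  refine moment_compare m (gm (2 * m)) (gm_nonneg m)
    (fun f => ∫ ω, ∏ i, X (f i) ω ∂μ) (fun f => ∫ ω, ∏ i, Y (f i) ω ∂ν)
    (fun a b => ∫ ω, X a ω * X b ω ∂μ) (fun a b => ∫ ω, Y a ω * Y b ω ∂ν)
    ?_ ?_ ?_ ?_ hcov f
  · intro t; rw [← h.expand, h.moments]
  · intro t; rw [← h'.expand, h'.moments]
  · intro f g hfg; exact integral_congr_ae (.of_forall fun ω => hsym (fun a => X a ω) f g hfg)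
  · intro f g hfg; exact integral_congr_ae (.of_forall fun ω => hsym (fun a => Y a ω) f g hfg)

lemma GaussFam.trace_integrable {Ω : Type*} [MeasurableSpace Ω]
    {μ : Measure Ω} [IsProbabilityMeasure μ] {n : ℕ} {X : Ω → Matrix (Fin n) (Fin n) ℝ}
    (h : GaussFam μ (fun p : Fin n × Fin n => fun ω => X ω p.1 p.2)) (N : ℕ) :
    Integrable (fun ω => ((X ω) ^ N).trace) μ := by
  simp only [Matrix.trace, Matrix.diag]
  refine integrable_finsetSum _ fun i _ => ?_
  obtain ⟨s, _, φ, hφ⟩ := trace_paths n N i i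
  simp only [hφ]
  exact integrable_finsetSum _ fun x _ => h.integrable_prod (φ x)

lemma GaussFam.trace_compare {Ω Ω' : Type*} [MeasurableSpace Ω] [MeasurableSpace Ω']
    {μ : Measure Ω} [IsProbabilityMeasure μ] {n : ℕ} {X : Ω → Matrix (Fin n) (Fin n) ℝ}
    (h : GaussFam μ (fun p : Fin n × Fin n => fun ω => X ω p.1 p.2))
    {ν : Measure Ω'} [IsProbabilityMeasure ν] {Y : Ω' → Matrix (Fin n) (Fin n) ℝ}
    (h' : GaussFam ν (fun p : Fin n × Fin n => fun ω => Y ω p.1 p.2))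
    (hcov : ∀ a b : Fin n × Fin n, |∫ ω, X ω a.1 a.2 * X ω b.1 b.2 ∂μ| ≤
      ∫ ω, Y ω a.1 a.2 * Y ω b.1 b.2 ∂ν) (m : ℕ) :
    ∫ ω, ((X ω) ^ (2 * m)).trace ∂μ ≤ ∫ ω, ((Y ω) ^ (2 * m)).trace ∂ν := by
  have key : ∀ i, ∃ (s : Type) (_ : Fintype s)
    (φ : s → Fin (2 * m) → Fin n × Fin n), ∀ A : Matrix (Fin n) (Fin n) ℝ,
      (A ^ (2 * m)) i i = ∑ x, ∏ l, A (φ x l).1 (φ x l).2 := fun i => trace_paths n (2 * m) i i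
  choose s hs φ hφ using key
  simp only [Matrix.trace, Matrix.diag, hφ]
  rw [integral_finsetSum _ (fun i _ => integrable_finsetSum _
      fun x _ => h.integrable_prod (φ i x)),
    integral_finsetSum _ (fun i _ => integrable_finsetSum _
      fun x _ => h'.integrable_prod (φ i x))]
  apply Finset.sum_le_sum
  intro i _
  rw [integral_finsetSum _ (fun x _ => h.integrable_prod (φ i x)),
    integral_finsetSum _ (fun x _ => h'.integrable_prod (φ i x))]
  exact Finset.sum_le_sum fun x _ => h.compare h' hcov m (φ i x)

lemma std_law {o : Type*} [Fintype o] [DecidableEq o] (c : o → ℝ) :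
    (stdGaussian (EuclideanSpace ℝ o)).map (fun x => ∑ i, c i * x i) =
      gaussianReal 0 (∑ i, c i ^ 2).toNNReal := by
  have h := IsGaussian.map_eq_gaussianReal (μ := stdGaussian (EuclideanSpace ℝ o))
    (innerSL ℝ (WithLp.toLp 2 c))
  rw [integral_strongDual_stdGaussian, variance_dual_stdGaussian, innerSL_apply_norm,
    EuclideanSpace.real_norm_sq_eq] at h
  rw [← h]
  congr 1
  ext x
  simp [PiLp.inner_apply, mul_comm]

lemma std_moment {o : Type*} [Fintype o] [DecidableEq o] (c : o → ℝ) (m : ℕ) :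
    ∫ x, (∑ i, c i * x i) ^ (2 * m) ∂(stdGaussian (EuclideanSpace ℝ o)) =
      gm (2 * m) * (∑ i, c i ^ 2) ^ m := by
  have h := gm_scale (∑ i, c i ^ 2).toNNReal m
  rw [← std_law c, integral_map (by fun_prop) (by fun_prop),
    Real.coe_toNNReal _ (Finset.sum_nonneg fun _ _ => sq_nonneg _)] at h
  exact h

lemma std_moment_integrable {o : Type*} [Fintype o] [DecidableEq o] (c : o → ℝ) (m : ℕ) :
    Integrable (fun x => (∑ i, c i * x i) ^ m) (stdGaussian (EuclideanSpace ℝ o)) := by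
  have h := integrable_pow_gaussian (∑ i, c i ^ 2).toNNReal m
  rw [← std_law c, integrable_map_measure (by fun_prop) (by fun_prop)] at h
  exact h

lemma std_fam {o ι : Type*} [Fintype o] [DecidableEq o] [Fintype ι] (B : ι → o → ℝ) :
    GaussFam (stdGaussian (EuclideanSpace ℝ o)) (fun a x => ∑ i, B a i * x i) where
  meas := fun i => by fun_prop
  law := fun c => by
    refine ⟨_, (Eq.trans ?_ (std_law (fun i => ∑ a, c a * B a i)))⟩
    congr 1
    ext x
    simp only [Finset.mul_sum, Finset.sum_mul]
    rw [Finset.sum_comm]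
    simp only [mul_assoc]

lemma std_cov {o : Type*} [Fintype o] [DecidableEq o] (b c : o → ℝ) :
    ∫ x, (∑ i, b i * x i) * (∑ i, c i * x i) ∂(stdGaussian (EuclideanSpace ℝ o)) =
      ∑ i, b i * c i := by
  have e : ∀ x : EuclideanSpace ℝ o, (∑ i, b i * x i) * (∑ i, c i * x i) =
      (1/4) * ((∑ i, (b i + c i) * x i) ^ (2 * 1) - (∑ i, (b i - c i) * x i) ^ (2 * 1)) := by
    intro x
    simp only [add_mul, sub_mul, Finset.sum_add_distrib, Finset.sum_sub_distrib]
    ring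
  simp_rw [e]
  rw [integral_const_mul, integral_sub (std_moment_integrable (fun i => b i + c i) _)
    (std_moment_integrable (fun i => b i - c i) _), std_moment (fun i => b i + c i),
    std_moment (fun i => b i - c i), gm_one, one_mul, one_mul, pow_one, pow_one,
    ← Finset.sum_sub_distrib, Finset.mul_sum]
  apply Finset.sum_congr rfl
  intro i _
  ring

section vol
open Metric

lemma vol_lower {n : ℕ} (T : EuclideanSpace ℝ (Fin n) →L[ℝ] EuclideanSpace ℝ (Fin n))
    (q : ℕ) (hq : q ≠ 0) :
    ENNReal.ofReal ((3 / 8 * ‖T‖) ^ (2 * q)) *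
      (volume (ball (0 : EuclideanSpace ℝ (Fin n)) (1/4))) ^ 2 ≤
    ∫⁻ z in (ball (0 : EuclideanSpace ℝ (Fin n)) (5/4)) ×ˢ
      (ball (0 : EuclideanSpace ℝ (Fin n)) (5/4)),
      ENNReal.ofReal ((inner ℝ z.1 (T z.2)) ^ (2 * q)) ∂(volume.prod volume) := by
  rcases (norm_nonneg T).eq_or_lt with h0 | hpos
  · rw [← h0]; simp [hq]
  obtain ⟨u, hu1, hu2⟩ := ContinuousLinearMap.exists_lt_apply_of_lt_opNorm T
    (show 15 / 16 * ‖T‖ < ‖T‖ by linarith)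
  have hTu : 0 < ‖T u‖ := lt_trans (by positivity) hu2
  set v : EuclideanSpace ℝ (Fin n) := (‖T u‖)⁻¹ • T u with hv
  have hvn : ‖v‖ = 1 := by rw [hv, norm_smul, norm_inv, norm_norm]; field_simp
  have hvT : inner ℝ v (T u) = ‖T u‖ := by
    rw [hv, real_inner_smul_left, real_inner_self_eq_norm_sq]; field_simp
  have hTu' : ‖T u‖ ≤ ‖T‖ := by
    calc ‖T u‖ ≤ ‖T‖ * ‖u‖ := T.le_opNorm u
      _ ≤ ‖T‖ * 1 := by gcongr
      _ = _ := mul_one _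
  calc ENNReal.ofReal ((3 / 8 * ‖T‖) ^ (2 * q)) *
      (volume (ball (0 : EuclideanSpace ℝ (Fin n)) (1/4))) ^ 2
      = ∫⁻ z in (ball v (1/4)) ×ˢ (ball u (1/4)),
        ENNReal.ofReal ((3 / 8 * ‖T‖) ^ (2 * q)) ∂(volume.prod volume) := by
        rw [setLIntegral_const, Measure.prod_prod, Measure.addHaar_ball_center volume v,
          Measure.addHaar_ball_center volume u, sq]
    _ ≤ ∫⁻ z in (ball v (1/4)) ×ˢ (ball u (1/4)),
      ENNReal.ofReal ((inner ℝ z.1 (T z.2)) ^ (2 * q)) ∂(volume.prod volume) := by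
        apply setLIntegral_mono' (measurableSet_ball.prod measurableSet_ball)
        rintro ⟨a, b⟩ ⟨ha, hb⟩
        simp only [mem_ball, dist_eq_norm] at ha hb
        apply ENNReal.ofReal_le_ofReal
        gcongr
        have e : inner ℝ a (T b) = inner ℝ v (T u) + inner ℝ (a - v) (T u) +
            inner ℝ a (T (b - u)) := by
          rw [map_sub, inner_sub_right, inner_sub_left]; ring
        have h1 : |inner ℝ (a - v) (T u)| ≤ 1/4 * ‖T‖ :=
          (abs_real_inner_le_norm _ _).trans (by gcongr)
        have han : ‖a‖ ≤ 5/4 := by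
          have := norm_add_le (a - v) v
          rw [sub_add_cancel, hvn] at this
          linarith
        have h2 : |inner ℝ a (T (b - u))| ≤ 5/4 * (‖T‖ * (1/4)) :=
          (abs_real_inner_le_norm _ _).trans
            (mul_le_mul han ((T.le_opNorm _).trans (by gcongr)) (by positivity) (by positivity))
        have := (abs_le.1 h1).1
        have := (abs_le.1 h2).1
        change _ ≤ inner ℝ a (T b)
        rw [e, hvT]
        linarith
    _ ≤ _ := by
        apply lintegral_mono_set
        apply Set.prod_mono
        · apply ball_subset_ball'; rw [dist_zero_right, hvn]; norm_num
        · apply ball_subset_ball'; rw [dist_zero_right]; linarith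
end vol

section normH
open Metric
open scoped Matrix.Norms.L2Operator

def Hmat {n : ℕ} (x : EuclideanSpace ℝ (Option (Fin n × Fin n))) : Matrix (Fin n) (Fin n) ℝ :=
  Matrix.of fun i j => x (some (i, j))

lemma inner_Hmat {n : ℕ} (x : EuclideanSpace ℝ (Option (Fin n × Fin n)))
    (v w : EuclideanSpace ℝ (Fin n)) :
    inner ℝ v (Matrix.toEuclideanCLM (n := Fin n) (𝕜 := ℝ) (Hmat x) w) =
      ∑ o : Option (Fin n × Fin n), (o.elim 0 (fun p => v p.1 * w p.2)) * x o := by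
  rw [Matrix.inner_toEuclideanCLM, Fintype.sum_option]
  simp only [Option.elim, zero_mul, zero_add, Fintype.sum_prod_type, dotProduct, Matrix.mulVec,
    Hmat, Matrix.of_apply, Finset.mul_sum]
  refine Finset.sum_congr rfl fun i _ => Finset.sum_congr rfl fun j _ => ?_
  ring

lemma lintegral_inner_Hmat {n : ℕ} (v w : EuclideanSpace ℝ (Fin n)) (q : ℕ) :
    ∫⁻ x, ENNReal.ofReal
      ((inner ℝ v (Matrix.toEuclideanCLM (n := Fin n) (𝕜 := ℝ) (Hmat x) w)) ^ (2 * q))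
      ∂(stdGaussian (EuclideanSpace ℝ (Option (Fin n × Fin n)))) =
    ENNReal.ofReal (gm (2 * q) * (‖v‖ ^ 2 * ‖w‖ ^ 2) ^ q) := by
  simp_rw [inner_Hmat]
  rw [← ofReal_integral_eq_lintegral_ofReal (std_moment_integrable _ _)
    (.of_forall fun x => by simp only [pow_mul]; positivity), std_moment]
  congr 3
  rw [Fintype.sum_option, EuclideanSpace.real_norm_sq_eq, EuclideanSpace.real_norm_sq_eq,
    Finset.sum_mul_sum, Fintype.sum_prod_type]
  simp [mul_pow]

lemma lintegral_norm_Hmat {n : ℕ} (hn : n ≠ 0) :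
    ∫⁻ x, ENNReal.ofReal (‖Hmat x‖ ^ (2 * n))
      ∂(stdGaussian (EuclideanSpace ℝ (Option (Fin n × Fin n)))) ≤
    ENNReal.ofReal ((6000 * n) ^ n) := by
  set ν := stdGaussian (EuclideanSpace ℝ (Option (Fin n × Fin n))) with hν
  set V := volume (ball (0 : EuclideanSpace ℝ (Fin n)) (1/4)) with hV
  have hV0 : V ≠ 0 := (measure_ball_pos _ _ (by norm_num)).ne'
  have hVt : V ≠ ⊤ := measure_ball_lt_top.ne
  have hV5 : volume (ball (0 : EuclideanSpace ℝ (Fin n)) (5/4)) = ENNReal.ofReal (5 ^ n) * V := by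
    have := Measure.addHaar_ball_mul_of_pos (volume : Measure (EuclideanSpace ℝ (Fin n))) 0
      (show (0:ℝ) < 5 by norm_num) (1/4)
    rw [finrank_euclideanSpace_fin] at this
    rw [← this]; norm_num
  set S := (ball (0 : EuclideanSpace ℝ (Fin n)) (5/4)) ×ˢ
      (ball (0 : EuclideanSpace ℝ (Fin n)) (5/4)) with hS
  have hSm : MeasurableSet S := measurableSet_ball.prod measurableSet_ball
  have step : (∫⁻ x, ENNReal.ofReal (‖Hmat x‖ ^ (2 * n)) ∂ν) *
      (ENNReal.ofReal ((3/8) ^ (2 * n)) * V ^ 2) ≤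
      ENNReal.ofReal (gm (2 * n) * (25/16 * (25/16)) ^ n) * (ENNReal.ofReal (5 ^ n) * V) ^ 2 := by
    calc _ ≤ ∫⁻ x, ENNReal.ofReal (‖Hmat x‖ ^ (2 * n)) *
          (ENNReal.ofReal ((3/8) ^ (2 * n)) * V ^ 2) ∂ν := by
          apply lintegral_mul_const_le
      _ ≤ ∫⁻ x, ∫⁻ z in S, ENNReal.ofReal ((inner ℝ z.1
          (Matrix.toEuclideanCLM (n := Fin n) (𝕜 := ℝ) (Hmat x) z.2)) ^ (2 * n))
          ∂(volume.prod volume) ∂ν := by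
          apply lintegral_mono
          intro x
          refine le_trans (le_of_eq ?_) (vol_lower _ n hn)
          rw [Matrix.l2_opNorm_toEuclideanCLM, mul_pow, ENNReal.ofReal_mul (by positivity)]
          ring
      _ = ∫⁻ z in S, ∫⁻ x, ENNReal.ofReal ((inner ℝ z.1
          (Matrix.toEuclideanCLM (n := Fin n) (𝕜 := ℝ) (Hmat x) z.2)) ^ (2 * n))
          ∂ν ∂(volume.prod volume) := by
          apply lintegral_lintegral_swap
          apply Measurable.aemeasurable
          simp only [inner_Hmat, Function.uncurry_def]
          apply ENNReal.measurable_ofReal.comp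
          apply Continuous.measurable
          refine Continuous.pow (continuous_finsetSum _ fun o _ => ?_) _
          cases o with
          | none => simp only [Option.elim]; fun_prop
          | some p => simp only [Option.elim]; fun_prop
      _ ≤ ∫⁻ z in S, ENNReal.ofReal (gm (2 * n) * (25/16 * (25/16)) ^ n)
          ∂(volume.prod volume) := by
          apply setLIntegral_mono' hSm
          rintro ⟨a, b⟩ ⟨ha, hb⟩
          simp only [mem_ball, dist_zero_right] at ha hb
          rw [lintegral_inner_Hmat]
          apply ENNReal.ofReal_le_ofReal
          have := gm_nonneg n
          gcongr
          · nlinarith [norm_nonneg a]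
          · nlinarith [norm_nonneg b]
      _ = _ := by
          rw [setLIntegral_const, hS, Measure.prod_prod, hV5, sq]
  have hV2 : V ^ 2 ≠ 0 := pow_ne_zero _ hV0
  have hV2t : V ^ 2 ≠ ⊤ := ENNReal.pow_ne_top hVt
  have step2 : (∫⁻ x, ENNReal.ofReal (‖Hmat x‖ ^ (2 * n)) ∂ν) * ENNReal.ofReal ((3/8) ^ (2 * n)) ≤
      ENNReal.ofReal (gm (2 * n) * (25/16 * (25/16)) ^ n * (5 ^ n) ^ 2) := by
    rw [← ENNReal.mul_le_mul_iff_left hV2 hV2t]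
    rw [ENNReal.ofReal_mul (mul_nonneg (gm_nonneg n) (by positivity)),
      ENNReal.ofReal_pow (by positivity) 2]
    calc _ = _ := by ring
      _ ≤ _ := step
      _ = _ := by ring
  have h38 : ENNReal.ofReal ((3/8) ^ (2 * n)) ≠ 0 := by
    rw [Ne, ENNReal.ofReal_eq_zero, not_le]; positivity
  rw [← ENNReal.mul_le_mul_iff_left h38 ENNReal.ofReal_ne_top]
  refine step2.trans ?_
  rw [← ENNReal.ofReal_mul (by positivity)]
  apply ENNReal.ofReal_le_ofReal
  have := gm_bound n
  calc gm (2 * n) * (25/16 * (25/16)) ^ n * (5 ^ n) ^ 2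
      ≤ (12 * (n:ℝ)) ^ n * (25/16 * (25/16)) ^ n * (5 ^ n) ^ 2 := by gcongr
    _ = (12 * (n:ℝ) * (25/16 * (25/16)) * 25) ^ n := by
      rw [← pow_mul, mul_comm n 2, pow_mul, ← mul_pow, ← mul_pow]; norm_num
    _ ≤ (6000 * (n:ℝ) * (3/8)^2) ^ n := by
      apply pow_le_pow_left₀ (by positivity)
      have : (0:ℝ) ≤ n := by positivity
      nlinarith
    _ = _ := by rw [mul_pow _ ((3/8 : ℝ)^2), pow_mul]
end normH

section trace
open scoped Matrix.Norms.L2Operator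

lemma norm_sq_le_frob {n : ℕ} (A : Matrix (Fin n) (Fin n) ℝ) :
    ‖A‖ ^ 2 ≤ ∑ i, ∑ j, A i j ^ 2 := by
  have h0 : 0 ≤ ∑ i, ∑ j, A i j ^ 2 :=
    Finset.sum_nonneg fun i _ => Finset.sum_nonneg fun j _ => sq_nonneg _
  have : ‖A‖ ≤ Real.sqrt (∑ i, ∑ j, A i j ^ 2) := by
    rw [← Matrix.l2_opNorm_toEuclideanCLM]
    apply ContinuousLinearMap.opNorm_le_bound _ (Real.sqrt_nonneg _)
    intro x
    rw [← Real.sqrt_sq (norm_nonneg x), ← Real.sqrt_mul h0]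
    apply Real.le_sqrt_of_sq_le
    rw [EuclideanSpace.real_norm_sq_eq, EuclideanSpace.real_norm_sq_eq, Finset.sum_mul]
    apply Finset.sum_le_sum
    intro i _
    rw [Matrix.ofLp_toEuclideanCLM]
    exact Finset.sum_mul_sq_le_sq_mul_sq Finset.univ (fun j => A i j) (fun j => x j)
  calc ‖A‖ ^ 2 ≤ Real.sqrt (∑ i, ∑ j, A i j ^ 2) ^ 2 := by gcongr
    _ = _ := Real.sq_sqrt h0

lemma quad_le {n : ℕ} (A : Matrix (Fin n) (Fin n) ℝ) (v : Fin n → ℝ) :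
    |v ⬝ᵥ A.mulVec v| ≤ ‖A‖ * ∑ i, v i ^ 2 := by
  have h := abs_real_inner_le_norm (WithLp.toLp 2 v)
    (Matrix.toEuclideanCLM (n := Fin n) (𝕜 := ℝ) A (WithLp.toLp 2 v))
  rw [Matrix.inner_toEuclideanCLM] at h
  refine h.trans ?_
  have h2 := (Matrix.toEuclideanCLM (n := Fin n) (𝕜 := ℝ) A).le_opNorm (WithLp.toLp 2 v)
  rw [Matrix.l2_opNorm_toEuclideanCLM] at h2
  have h3 : ‖WithLp.toLp 2 v‖ ^ 2 = ∑ i, v i ^ 2 := by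
    rw [EuclideanSpace.real_norm_sq_eq]
  rw [← h3]
  nlinarith [norm_nonneg (WithLp.toLp 2 v)]

lemma diag_le {n : ℕ} (A : Matrix (Fin n) (Fin n) ℝ) (i : Fin n) : A i i ≤ ‖A‖ := by
  have h := quad_le A (Pi.single i 1)
  have e : ∑ j, (Pi.single i 1 : Fin n → ℝ) j ^ 2 = 1 := by
    simp [Pi.single_apply]
  rw [e, mul_one] at h
  simp at h
  exact (le_abs_self _).trans h

lemma trace_pow_le {n : ℕ} (A : Matrix (Fin n) (Fin n) ℝ) (N : ℕ) (hN : 0 < N) :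
    (A ^ N).trace ≤ n * ‖A‖ ^ N := by
  calc (A ^ N).trace = ∑ i, (A ^ N) i i := rfl
    _ ≤ ∑ i : Fin n, ‖A‖ ^ N := Finset.sum_le_sum fun i _ =>
        (diag_le _ i).trans (norm_pow_le' A hN)
    _ = _ := by simp

lemma trace_even_eq {n : ℕ} (A : Matrix (Fin n) (Fin n) ℝ) (hA : A.IsSymm) (k : ℕ) :
    (A ^ (2 * k)).trace = ∑ i, ∑ j, (A ^ k) i j ^ 2 := by
  rw [two_mul, pow_add, Matrix.trace]
  simp only [Matrix.diag, Matrix.mul_apply]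
  refine Finset.sum_congr rfl fun i _ => Finset.sum_congr rfl fun j _ => ?_
  rw [(hA.pow k).apply i j, sq]

lemma trace_even_nonneg {n : ℕ} (A : Matrix (Fin n) (Fin n) ℝ) (hA : A.IsSymm) (k : ℕ) :
    0 ≤ (A ^ (2 * k)).trace := by
  rw [trace_even_eq A hA]
  exact Finset.sum_nonneg fun i _ => Finset.sum_nonneg fun j _ => sq_nonneg _

lemma norm_pow_le_trace {n : ℕ} (A : Matrix (Fin n) (Fin n) ℝ) (hA : A.IsSymm) (m : ℕ) :
    ‖A‖ ^ (2 * 2 ^ m) ≤ (A ^ (2 * 2 ^ m)).trace := by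
  rw [trace_even_eq A hA]
  refine le_trans (le_of_eq ?_) (norm_sq_le_frob _)
  have hs : IsSelfAdjoint A := by
    rw [IsSelfAdjoint, Matrix.star_eq_conjTranspose, Matrix.conjTranspose_eq_transpose_of_trivial]
    exact hA
  rw [hs.norm_pow_two_pow, ← pow_mul, mul_comm]

/-- coefficients of the dominating Gaussian family -/
def Bc {n : ℕ} (r : ℝ) (a : Fin n × Fin n) (o : Option (Fin n × Fin n)) : ℝ :=
  o.elim r (fun p => (if p = a then 1 else 0) + (if p = a.swap then 1 else 0))

def Ymat {n : ℕ} (r : ℝ) (x : EuclideanSpace ℝ (Option (Fin n × Fin n))) :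
    Matrix (Fin n) (Fin n) ℝ := Matrix.of fun i j => ∑ o, Bc r (i, j) o * x o

lemma Ymat_eq {n : ℕ} (r : ℝ) (x : EuclideanSpace ℝ (Option (Fin n × Fin n))) :
    Ymat r x = Hmat x + (Hmat x).transpose + (r * x none) • onesMat n := by
  ext i j
  simp [Ymat, Bc, Hmat, onesMat, Fintype.sum_option, add_mul, Finset.sum_add_distrib]
  ring

lemma Ymat_symm {n : ℕ} (r : ℝ) (x : EuclideanSpace ℝ (Option (Fin n × Fin n))) :
    (Ymat r x).IsSymm := by
  rw [Ymat_eq]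
  ext i j
  simp [onesMat]
  ring

lemma norm_ones_le (n : ℕ) : ‖onesMat n‖ ≤ n := by
  have h := norm_sq_le_frob (onesMat n)
  simp [onesMat] at h
  exact abs_le_of_sq_le_sq' (by simpa [onesMat, sq] using h) (by positivity) |>.2

lemma norm_Ymat_le {n : ℕ} (r : ℝ) (hr : 0 ≤ r)
    (x : EuclideanSpace ℝ (Option (Fin n × Fin n))) :
    ‖Ymat r x‖ ≤ 2 * ‖Hmat x‖ + r * n * |x none| := by
  rw [Ymat_eq]
  have h1 : ‖(Hmat x).transpose‖ = ‖Hmat x‖ := by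
    rw [← Matrix.conjTranspose_eq_transpose_of_trivial, Matrix.l2_opNorm_conjTranspose]
  have h2 : ‖(r * x none) • onesMat n‖ ≤ r * |x none| * n := by
    rw [norm_smul, Real.norm_eq_abs, abs_mul, abs_of_nonneg hr]
    gcongr
    exact norm_ones_le n
  have := norm_add_le (Hmat x + (Hmat x).transpose) ((r * x none) • onesMat n)
  have := norm_add_le (Hmat x) (Hmat x).transpose
  linarith

lemma Ymat_fam {n : ℕ} (r : ℝ) :
    GaussFam (stdGaussian (EuclideanSpace ℝ (Option (Fin n × Fin n))))
      (fun p : Fin n × Fin n => fun x => Ymat r x p.1 p.2) :=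
  std_fam (fun a : Fin n × Fin n => Bc r a)

lemma Bc_nonneg {n : ℕ} (r : ℝ) (hr : 0 ≤ r) (a : Fin n × Fin n) (o) : 0 ≤ Bc r a o := by
  cases o with
  | none => exact hr
  | some p => simp only [Bc, Option.elim]; positivity

lemma Ymat_cov_ge {n : ℕ} (r : ℝ) (hr : 0 ≤ r) (a b : Fin n × Fin n)
    (o : Option (Fin n × Fin n)) :
    Bc r a o * Bc r b o ≤ ∫ x, Ymat r x a.1 a.2 * Ymat r x b.1 b.2
      ∂(stdGaussian (EuclideanSpace ℝ (Option (Fin n × Fin n)))) := by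
  have := std_cov (Bc r a) (Bc r b)
  change _ ≤ ∫ x : EuclideanSpace ℝ (Option (Fin n × Fin n)), (∑ i, Bc r a i * x i) * (∑ i, Bc r b i * x i) ∂_
  rw [this]
  exact Finset.single_le_sum (f := fun o => Bc r a o * Bc r b o)
    (fun o _ => mul_nonneg (Bc_nonneg r hr a o) (Bc_nonneg r hr b o)) (Finset.mem_univ o)

lemma split_pow (s a : ℝ) (ha : 0 < a) {k n : ℕ} (hk : k ≤ n) :
    s ^ (2 * k) ≤ a ^ k + (a ^ (n - k))⁻¹ * s ^ (2 * n) := by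
  rw [pow_mul, pow_mul]
  rcases le_total (s ^ 2) a with h | h
  · have : (s ^ 2) ^ k ≤ a ^ k := by gcongr
    have : 0 ≤ (a ^ (n - k))⁻¹ * (s ^ 2) ^ n := by positivity
    linarith
  · have h1 : a ^ (n - k) ≤ (s ^ 2) ^ (n - k) := by gcongr
    have h2 : (s ^ 2) ^ n = (s ^ 2) ^ (n - k) * (s ^ 2) ^ k := by
      rw [← pow_add]; congr 1; omega
    have h3 : (s ^ 2) ^ k ≤ (a ^ (n - k))⁻¹ * (s ^ 2) ^ n := by
      rw [inv_mul_eq_div, le_div_iff₀ (by positivity), h2, mul_comm]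
      gcongr
    have : 0 < a ^ k := by positivity
    linarith

lemma Ymat_trace_bound {n : ℕ} (r : ℝ) (hr : 0 ≤ r) (k : ℕ) (hk : 0 < k) (hkn : k ≤ n)
    (hrk : r ^ 2 * n ^ 2 * (12 * k) ≤ n) :
    ∫ x, ((Ymat r x) ^ (2 * k)).trace
      ∂(stdGaussian (EuclideanSpace ℝ (Option (Fin n × Fin n)))) ≤ n * (288000 * n) ^ k := by
  set ν := stdGaussian (EuclideanSpace ℝ (Option (Fin n × Fin n))) with hν
  have hn : 0 < n := by omega
  have hn' : (0:ℝ) < n := by exact_mod_cast hn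
  set a : ℝ := 6000 * n with ha
  have ha0 : 0 < a := by positivity
  have hpt : ∀ x : EuclideanSpace ℝ (Option (Fin n × Fin n)), ((Ymat r x) ^ (2 * k)).trace ≤
      n * 4 ^ k * (4 ^ k * a ^ k + (r * n) ^ (2 * k) * (x none) ^ (2 * k))
        + n * 4 ^ k * 4 ^ k * (a ^ (n - k))⁻¹ * ‖Hmat x‖ ^ (2 * n) := by
    intro x
    have h1 := trace_pow_le (Ymat r x) (2 * k) (by omega)
    have h2 : ‖Ymat r x‖ ^ (2 * k) ≤ (2 * ‖Hmat x‖ + r * n * |x none|) ^ (2 * k) := by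
      gcongr; exact norm_Ymat_le r hr x
    have h3 : (2 * ‖Hmat x‖ + r * n * |x none|) ^ (2 * k) ≤
        4 ^ k * ((2 * ‖Hmat x‖) ^ (2 * k) + (r * n * |x none|) ^ (2 * k)) := by
      refine (add_pow_le (by positivity) (by positivity) (2 * k)).trans ?_
      gcongr
      rw [show (4:ℝ) = 2 ^ 2 by norm_num, ← pow_mul]
      exact pow_le_pow_right₀ (by norm_num) (by omega)
    have h4 := split_pow ‖Hmat x‖ a ha0 hkn
    have h5 : (2 * ‖Hmat x‖) ^ (2 * k) = 4 ^ k * ‖Hmat x‖ ^ (2 * k) := by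
      rw [mul_pow, pow_mul 2]; norm_num
    have h6 : (r * n * |x none|) ^ (2 * k) = (r * n) ^ (2 * k) * (x none) ^ (2 * k) := by
      rw [mul_pow, pow_mul |x none|, sq_abs, ← pow_mul]
    rw [h5, h6] at h3
    calc _ ≤ _ := h1
      _ ≤ n * (4 ^ k * (4 ^ k * (a ^ k + (a ^ (n - k))⁻¹ * ‖Hmat x‖ ^ (2 * n)) +
          (r * n) ^ (2 * k) * (x none) ^ (2 * k))) := by
        apply mul_le_mul_of_nonneg_left _ hn'.le
        refine h2.trans (h3.trans ?_)
        gcongr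
      _ = _ := by ring
  have hgint : Integrable (fun x : EuclideanSpace ℝ (Option (Fin n × Fin n)) =>
      (x none) ^ (2 * k)) ν := by
    have := std_moment_integrable (fun o : Option (Fin n × Fin n) => o.elim (1:ℝ) (fun _ => 0))
      (2 * k)
    simpa [Fintype.sum_option] using this
  have hg : ∫ x : EuclideanSpace ℝ (Option (Fin n × Fin n)), (x none) ^ (2 * k) ∂ν =
      gm (2 * k) := by
    have := std_moment (fun o : Option (Fin n × Fin n) => o.elim (1:ℝ) (fun _ => 0)) k
    simpa [Fintype.sum_option] using this
  have hF : Integrable (fun x : EuclideanSpace ℝ (Option (Fin n × Fin n)) =>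
      n * 4 ^ k * (4 ^ k * a ^ k + (r * n) ^ (2 * k) * (x none) ^ (2 * k))) ν :=
    ((integrable_const _).add (hgint.const_mul _)).const_mul _
  have hFnn : ∀ x : EuclideanSpace ℝ (Option (Fin n × Fin n)),
      0 ≤ n * 4 ^ k * (4 ^ k * a ^ k + (r * n) ^ (2 * k) * (x none) ^ (2 * k)) := by
    intro x
    have : 0 ≤ (x none) ^ (2 * k) := by rw [pow_mul]; positivity
    positivity
  have hFval : ∫ x : EuclideanSpace ℝ (Option (Fin n × Fin n)),
      n * 4 ^ k * (4 ^ k * a ^ k + (r * n) ^ (2 * k) * (x none) ^ (2 * k)) ∂ν =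
      n * 4 ^ k * (4 ^ k * a ^ k + (r * n) ^ (2 * k) * gm (2 * k)) := by
    rw [integral_const_mul, integral_add (integrable_const _) (hgint.const_mul _),
      integral_const, integral_const_mul, hg]
    simp
  have hgk : (r * n) ^ (2 * k) * gm (2 * k) ≤ (n:ℝ) ^ k := by
    calc (r * n) ^ (2 * k) * gm (2 * k) ≤ (r * n) ^ (2 * k) * (12 * k) ^ k := by
          gcongr; exact gm_bound k
      _ = (r ^ 2 * n ^ 2 * (12 * k)) ^ k := by rw [pow_mul, ← mul_pow, mul_pow r]
      _ ≤ _ := by gcongr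
  have main : ENNReal.ofReal (∫ x, ((Ymat r x) ^ (2 * k)).trace ∂ν) ≤
      ENNReal.ofReal (n * 4 ^ k * (4 ^ k * a ^ k + n ^ k) + n * 4 ^ k * 4 ^ k * a ^ k) := by
    rw [ofReal_integral_eq_lintegral_ofReal ((Ymat_fam r).trace_integrable _)
      (.of_forall fun x => trace_even_nonneg _ (Ymat_symm r x) k)]
    calc _ ≤ ∫⁻ x : EuclideanSpace ℝ (Option (Fin n × Fin n)), (ENNReal.ofReal
            (n * 4 ^ k * (4 ^ k * a ^ k + (r * n) ^ (2 * k) * (x none) ^ (2 * k))) +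
          ENNReal.ofReal (n * 4 ^ k * 4 ^ k * (a ^ (n - k))⁻¹) *
            ENNReal.ofReal (‖Hmat x‖ ^ (2 * n))) ∂ν := by
          apply lintegral_mono
          intro x
          simp only
          rw [← ENNReal.ofReal_mul (by positivity),
            ← ENNReal.ofReal_add (hFnn x) (by positivity)]
          exact ENNReal.ofReal_le_ofReal (hpt x)
      _ = ENNReal.ofReal (n * 4 ^ k * (4 ^ k * a ^ k + (r * n) ^ (2 * k) * gm (2 * k))) +
          ENNReal.ofReal (n * 4 ^ k * 4 ^ k * (a ^ (n - k))⁻¹) *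
            ∫⁻ x, ENNReal.ofReal (‖Hmat x‖ ^ (2 * n)) ∂ν := by
          rw [lintegral_add_left (by fun_prop), lintegral_const_mul' _ _ ENNReal.ofReal_ne_top,
            ← ofReal_integral_eq_lintegral_ofReal hF (.of_forall hFnn), hFval]
      _ ≤ ENNReal.ofReal (n * 4 ^ k * (4 ^ k * a ^ k + n ^ k)) +
          ENNReal.ofReal (n * 4 ^ k * 4 ^ k * (a ^ (n - k))⁻¹) *
            ENNReal.ofReal (a ^ n) := by
          gcongr
          exact lintegral_norm_Hmat hn.ne'
      _ = _ := by
          rw [← ENNReal.ofReal_mul (by positivity),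
            ← ENNReal.ofReal_add (by positivity) (by positivity)]
          congr 2
          have : a ^ n = a ^ (n - k) * a ^ k := by rw [← pow_add]; congr 1; omega
          rw [this]
          field_simp
  rw [ENNReal.ofReal_le_ofReal_iff (by positivity)] at main
  refine main.trans ?_
  have e1 : (288000 * (n:ℝ)) ^ k = 3 ^ k * (4 ^ k * (4 ^ k * a ^ k)) := by
    rw [← mul_pow, ← mul_pow, ← mul_pow, ha]; congr 1; ring
  have e2 : (n:ℝ) ^ k ≤ 4 ^ k * a ^ k := by
    rw [← mul_pow]; gcongr; rw [ha]; linarith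
  have e3 : (3:ℝ) ≤ 3 ^ k := by
    calc (3:ℝ) = 3 ^ 1 := by norm_num
      _ ≤ 3 ^ k := pow_le_pow_right₀ (by norm_num) hk
  rw [e1]
  calc n * 4 ^ k * (4 ^ k * a ^ k + n ^ k) + n * 4 ^ k * 4 ^ k * a ^ k
      ≤ n * 4 ^ k * (4 ^ k * a ^ k + 4 ^ k * a ^ k) + n * 4 ^ k * 4 ^ k * a ^ k := by gcongr
    _ = n * (3 * (4 ^ k * (4 ^ k * a ^ k))) := by ring
    _ ≤ _ := by gcongr
end trace

section eig
open scoped Matrix.Norms.L2Operator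

lemma eig_upper {n : ℕ} (A : Matrix (Fin n) (Fin n) ℝ) (c s : ℝ) (hc : 0 ≤ c)
    (hs : s = c * n) (t : ℝ) (v : Fin n → ℝ) (hv : v ≠ 0)
    (h : (A + c • onesMat n).mulVec v = t • v) : t ≤ ‖A‖ + s := by
  have hpos : 0 < ∑ i, v i ^ 2 := by
    obtain ⟨i, hi⟩ := Function.ne_iff.mp hv
    exact Finset.sum_pos' (fun i _ => sq_nonneg _) ⟨i, Finset.mem_univ _, by
      have : v i ≠ 0 := hi
      positivity⟩
  have h1 := congrArg (fun w => v ⬝ᵥ w) h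
  simp only [Matrix.add_mulVec, dotProduct_add, Matrix.smul_mulVec, dotProduct_smul,
    smul_eq_mul] at h1
  have h2 : v ⬝ᵥ v = ∑ i, v i ^ 2 := by
    simp [dotProduct, sq]
  have h3 : v ⬝ᵥ (onesMat n).mulVec v = (∑ i, v i) ^ 2 := by
    simp [dotProduct, Matrix.mulVec, onesMat, ← Finset.sum_mul, sq]
  have h4 : (∑ i, v i) ^ 2 ≤ n * ∑ i, v i ^ 2 := by
    simpa using sq_sum_le_card_mul_sum_sq (s := Finset.univ) (f := v)
  have h5 := (abs_le.mp (quad_le A v)).2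
  rw [h2, h3] at h1
  have h6 := mul_le_mul_of_nonneg_left h4 hc
  refine le_of_mul_le_mul_right ?_ hpos
  rw [← h1, hs]
  linarith

lemma lam1_close {n : ℕ} (hn : 0 < n) (A : Matrix (Fin n) (Fin n) ℝ) (hA : A.IsSymm)
    (c s : ℝ) (hc : 0 ≤ c) (hs : s = c * n) :
    |lam1 (A + c • onesMat n) - s| ≤ ‖A‖ := by
  have hn' : (0:ℝ) < n := by exact_mod_cast hn
  have hbdd : BddAbove {t : ℝ | ∃ v : Fin n → ℝ, v ≠ 0 ∧
      (A + c • onesMat n).mulVec v = t • v} :=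
    ⟨‖A‖ + s, fun t ⟨v, hv, h⟩ => eig_upper A c s hc hs t v hv h⟩
  have hs0 : 0 ≤ ‖A‖ + s := by rw [hs]; positivity
  have hup : lam1 (A + c • onesMat n) ≤ ‖A‖ + s :=
    Real.sSup_le (fun t ⟨v, hv, h⟩ => eig_upper A c s hc hs t v hv h) hs0
  set L := lam1 (A + c • onesMat n) with hL
  have hherm : (L • (1 : Matrix (Fin n) (Fin n) ℝ) - (A + c • onesMat n)).IsHermitian := by
    rw [Matrix.IsHermitian, Matrix.conjTranspose_eq_transpose_of_trivial]
    ext i j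
    have := congrFun (congrFun hA i) j
    simp only [Matrix.transpose_apply] at this
    simp [this, onesMat, Matrix.one_apply, eq_comm]
  have hpsd : (L • (1 : Matrix (Fin n) (Fin n) ℝ) - (A + c • onesMat n)).PosSemidef := by
    rw [hherm.posSemidef_iff_eigenvalues_nonneg]
    intro j
    have h1 := hherm.mulVec_eigenvectorBasis j
    have h2 : (WithLp.ofLp (hherm.eigenvectorBasis j)) ≠ 0 := by
      intro h0
      apply hherm.eigenvectorBasis.orthonormal.ne_zero j
      ext i
      exact congrFun h0 i
    have h3 : L - hherm.eigenvalues j ≤ L := by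
      apply le_csSup hbdd
      refine ⟨_, h2, ?_⟩
      rw [Matrix.sub_mulVec, Matrix.smul_mulVec, Matrix.one_mulVec] at h1
      rw [sub_smul, ← h1]
      abel
    simp only [Pi.zero_apply]
    linarith
  have h1 := hpsd.dotProduct_mulVec_nonneg (fun _ => (1:ℝ))
  have h5 := (abs_le.mp (quad_le A (fun _ => (1:ℝ)))).1
  have h2 : (fun _ : Fin n => (1:ℝ)) ⬝ᵥ (fun _ : Fin n => (1:ℝ)) = n := by
    simp [dotProduct]
  have h3 : (fun _ : Fin n => (1:ℝ)) ⬝ᵥ (onesMat n).mulVec (fun _ : Fin n => (1:ℝ)) = n * n := by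
    simp [dotProduct, Matrix.mulVec, onesMat]
  have e : star (fun _ : Fin n => (1:ℝ)) = fun _ => 1 := by ext; simp
  rw [e, Matrix.sub_mulVec, Matrix.add_mulVec, Matrix.smul_mulVec, Matrix.smul_mulVec,
    Matrix.one_mulVec, dotProduct_sub, dotProduct_add, dotProduct_smul, dotProduct_smul, h2, h3]
    at h1
  simp only [smul_eq_mul, one_pow, Finset.sum_const, Finset.card_univ, Fintype.card_fin,
    nsmul_eq_mul, mul_one] at h1 h5
  have hlow : s - ‖A‖ ≤ L := by
    refine le_of_mul_le_mul_right ?_ hn'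
    rw [hs]
    nlinarith
  rw [abs_le]
  constructor <;> linarith
end eig

section final
open scoped Matrix.Norms.L2Operator

lemma Bc_self {n : ℕ} (r : ℝ) (a : Fin n × Fin n) : 1 ≤ Bc r a (some a) := by
  simp only [Bc, Option.elim, if_true]
  split_ifs <;> norm_num

lemma Bc_swap {n : ℕ} (r : ℝ) (a : Fin n × Fin n) : 1 ≤ Bc r a.swap (some a) := by
  simp only [Bc, Option.elim, Prod.swap_swap, if_true]
  split_ifs <;> norm_num

lemma cov_check {Ω : Type*} [MeasureSpace Ω]
    (X : (n : ℕ) → Ω → Matrix (Fin n) (Fin n) ℝ) (C ε : ℝ)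
    (hX : CorrGaussian Ω X C ε) (n : ℕ) (r : ℝ) (hr : 0 ≤ r)
    (hr2 : r * r = C * (n:ℝ) ^ (-(1 + ε))) (a b : Fin n × Fin n) :
    |∫ ω, X n ω a.1 a.2 * X n ω b.1 b.2| ≤ ∫ x, Ymat r x a.1 a.2 * Ymat r x b.1 b.2
      ∂(stdGaussian (EuclideanSpace ℝ (Option (Fin n × Fin n)))) := by
  have hone : ∀ a : Fin n × Fin n, |∫ ω, X n ω a.1 a.2 * X n ω a.1 a.2| = 1 := by
    intro a
    have := hX.var_one n a.1 a.2
    simp only [sq] at this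
    rw [this]; simp
  have key : ∀ b : Fin n × Fin n, 1 ≤ Bc r b (some a) →
      1 ≤ ∫ x, Ymat r x a.1 a.2 * Ymat r x b.1 b.2
      ∂(stdGaussian (EuclideanSpace ℝ (Option (Fin n × Fin n)))) := fun b hb =>
    le_trans (by nlinarith [Bc_self r a]) (Ymat_cov_ge r hr a b (some a))
  by_cases h1 : a = b
  · subst h1
    rw [hone]
    exact key a (Bc_self r a)
  by_cases h2 : b = a.swap
  · subst h2
    have : ∀ ω, X n ω a.swap.1 a.swap.2 = X n ω a.1 a.2 := fun ω =>
      congrFun (congrFun (hX.symm n ω) a.1) a.2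
    simp only [this, hone]
    exact key _ (Bc_swap r a)
  · refine (hX.corr_le n a.1 a.2 b.1 b.2 ?_).trans ?_
    · rintro (h | h)
      · exact h1 h
      · apply h2
        rw [Prod.ext_iff] at h ⊢
        exact ⟨h.2.symm, h.1.symm⟩
    · rw [← hr2]
      exact Ymat_cov_ge r hr a b none

lemma trace_bound {Ω : Type*} [MeasureSpace Ω] [IsProbabilityMeasure (volume : Measure Ω)]
    (X : (n : ℕ) → Ω → Matrix (Fin n) (Fin n) ℝ) (C ε : ℝ) (hC : 0 < C)
    (hX : CorrGaussian Ω X C ε) (n k : ℕ) (hk : 0 < k) (hkn : k ≤ n)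
    (h : 12 * C * k ≤ (n:ℝ) ^ ε) :
    ∫ ω, ((X n ω) ^ (2 * k)).trace ≤ n * (288000 * n) ^ k := by
  have hn' : (0:ℝ) < n := by exact_mod_cast (by omega : 0 < n)
  have hq : 0 ≤ C * (n:ℝ) ^ (-(1 + ε)) := by positivity
  have hfam : GaussFam (volume : Measure Ω)
      (fun p : Fin n × Fin n => fun ω => X n ω p.1 p.2) :=
    ⟨(hX.gauss n).1, (hX.gauss n).2⟩
  refine (hfam.trace_compare (Ymat_fam (Real.sqrt (C * (n:ℝ) ^ (-(1 + ε)))))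
    (cov_check X C ε hX n _ (Real.sqrt_nonneg _) (Real.mul_self_sqrt hq)) k).trans ?_
  apply Ymat_trace_bound _ (Real.sqrt_nonneg _) k hk hkn
  rw [Real.sq_sqrt hq, neg_add, Real.rpow_add hn', Real.rpow_neg_one, Real.rpow_neg hn'.le]
  have : 0 < (n:ℝ) ^ ε := by positivity
  field_simp
  linarith

lemma prob_bound {Ω : Type*} [MeasureSpace Ω] [IsProbabilityMeasure (volume : Measure Ω)]
    (X : (n : ℕ) → Ω → Matrix (Fin n) (Fin n) ℝ) (C ε : ℝ) (hC : 0 < C)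
    (hX : CorrGaussian Ω X C ε) (n m : ℕ) (hkn : 2 ^ m ≤ n)
    (h : 12 * C * (2 ^ m : ℕ) ≤ (n:ℝ) ^ ε) (M : ℝ) (hM : 0 < M) :
    (volume : Measure Ω).real {ω | (M ^ 2 * n) ^ (2 ^ m) ≤ ((X n ω) ^ (2 * 2 ^ m)).trace} ≤
      n * (288000 / M ^ 2) ^ (2 ^ m) := by
  have hk : 0 < 2 ^ m := by positivity
  have hn' : (0:ℝ) < n := by exact_mod_cast (by omega : 0 < n)
  have hfam : GaussFam (volume : Measure Ω)
      (fun p : Fin n × Fin n => fun ω => X n ω p.1 p.2) :=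
    ⟨(hX.gauss n).1, (hX.gauss n).2⟩
  have h1 := mul_meas_ge_le_integral_of_nonneg
    (.of_forall fun ω => trace_even_nonneg _ (hX.symm n ω) (2 ^ m))
    (hfam.trace_integrable (2 * 2 ^ m)) ((M ^ 2 * n) ^ (2 ^ m))
  have h2 := h1.trans (trace_bound X C ε hC hX n (2 ^ m) hk hkn h)
  have h3 : (0:ℝ) < (M ^ 2 * n) ^ (2 ^ m) := by positivity
  refine le_of_mul_le_mul_left (h2.trans (le_of_eq ?_)) h3
  rw [mul_left_comm, ← mul_pow]
  congr 2
  field_simp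

lemma exists_m (c ε : ℝ) (hε : 0 < ε) : ∃ n₀ : ℕ, ∀ n ≥ n₀, 1 ≤ n ∧ ∃ m : ℕ,
    Real.log n ≤ (2 ^ m : ℕ) ∧ 2 ^ m ≤ n ∧ c * (2 ^ m : ℕ) ≤ (n:ℝ) ^ ε := by
  have A : ∀ K : ℝ, 0 < K → ∀ e : ℝ, 0 < e →
      ∀ᶠ n : ℕ in atTop, K * Real.log n ≤ (n:ℝ) ^ e := by
    intro K hK e he
    have := (isLittleO_log_rpow_atTop he).bound (show 0 < 1 / K by positivity)
    have := tendsto_natCast_atTop_atTop (R := ℝ) |>.eventually this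
    filter_upwards [this, eventually_ge_atTop 1] with n hn h1
    have h1' : (1:ℝ) ≤ n := by exact_mod_cast h1
    rw [Real.norm_of_nonneg (Real.log_nonneg h1'), Real.norm_of_nonneg (by positivity)] at hn
    rw [one_div, inv_mul_eq_div, le_div_iff₀ hK] at hn
    linarith
  have B := A (2 * (|c| + 1)) (by positivity) ε hε
  have D := A 2 (by norm_num) 1 one_pos
  have F : ∀ᶠ n : ℕ in atTop, (1:ℝ) ≤ Real.log n :=
    (Real.tendsto_log_atTop.comp tendsto_natCast_atTop_atTop).eventually_ge_atTop 1
  obtain ⟨n₀, h⟩ := eventually_atTop.mp (B.and (D.and (F.and (eventually_ge_atTop 1))))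
  refine ⟨n₀, fun n hn => ?_⟩
  obtain ⟨hB, hD, hF, h1⟩ := h n hn
  refine ⟨h1, ?_⟩
  rw [Real.rpow_one] at hD
  obtain ⟨m, hm1, hm2⟩ := exists_nat_pow_near hF (one_lt_two (α := ℝ))
  refine ⟨m + 1, ?_, ?_, ?_⟩
  · push_cast; exact hm2.le
  · have : ((2 ^ (m + 1) : ℕ) : ℝ) ≤ n := by
      push_cast; rw [pow_succ]; linarith
    exact_mod_cast this
  · refine le_trans ?_ hB
    push_cast
    rw [pow_succ]
    have h0 : (0:ℝ) ≤ 2 ^ m := by positivity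
    calc c * (2 ^ m * 2) ≤ (|c| + 1) * (2 ^ m * 2) := by
          gcongr; linarith [le_abs_self c]
      _ ≤ (|c| + 1) * (Real.log n * 2) := by gcongr
      _ = _ := by ring

lemma eig_event {n : ℕ} (hn : 1 ≤ n) (A : Matrix (Fin n) (Fin n) ℝ) (hA : A.IsSymm)
    (l : ℝ) (hl : 0 ≤ l) (M : ℝ) (hM : 0 ≤ M) (m : ℕ)
    (h : M * Real.sqrt n < |lam1 (A + (l / Real.sqrt n) • onesMat n) - l * Real.sqrt n|) :
    (M ^ 2 * n) ^ (2 ^ m) ≤ (A ^ (2 * 2 ^ m)).trace := by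
  have hn' : (0:ℝ) < n := by exact_mod_cast hn
  have hs : 0 < Real.sqrt n := Real.sqrt_pos.mpr hn'
  have h1 := lam1_close hn A hA (l / Real.sqrt n) (l * Real.sqrt n) (by positivity) (by
    have := Real.mul_self_sqrt hn'.le
    rw [div_mul_eq_mul_div, eq_div_iff hs.ne', mul_assoc, this])
  have h2 : M * Real.sqrt n ≤ ‖A‖ := (h.trans_le h1).le
  refine le_trans ?_ (norm_pow_le_trace A hA m)
  rw [pow_mul ‖A‖]
  have h3 : M ^ 2 * n = (M * Real.sqrt n) ^ 2 := by
    rw [mul_pow, Real.sq_sqrt hn'.le]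
  rw [h3]
  gcongr

end final

/-- `λ₁(Y_n) - λ_n √n = O_P(√n)` for `Y_n = X_n + (λ_n/√n) 𝟙𝟙ᵀ`. -/
theorem largest_eigenvalue_apriori_bound
    {Ω : Type*} [MeasureSpace Ω] [IsProbabilityMeasure (volume : Measure Ω)]
    (X : (n : ℕ) → Ω → Matrix (Fin n) (Fin n) ℝ) (C ε : ℝ)
    (hC : 0 < C) (hε : 0 < ε) (hX : CorrGaussian Ω X C ε)
    (lam : ℕ → ℝ) (D : ℝ) (hD : 0 < D)
    (hlam : ∀ n : ℕ, 1 ≤ n → 0 < lam n ∧ lam n ≤ D * Real.sqrt n) :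
    ∀ δ : ℝ, 0 < δ → ∃ M : ℝ, 0 < M ∧ ∃ n₀ : ℕ, ∀ n ≥ n₀,
      (volume {ω : Ω |
        M * Real.sqrt n <
          |lam1 (X n ω + (lam n / Real.sqrt n) • onesMat n) - lam n * Real.sqrt n|}).toReal
        ≤ δ := by
  intro δ hδ
  obtain ⟨n₁, h1⟩ := exists_m (12 * C) ε hε
  obtain ⟨n₂, h2⟩ := exists_nat_gt (1 / δ)
  refine ⟨Real.sqrt (288000 * Real.exp 2), by positivity, max n₁ n₂, fun n hn => ?_⟩
  obtain ⟨hn1, m, hm1, hm2, hm3⟩ := h1 n (le_of_max_le_left hn)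
  have hn2 : (n₂:ℝ) ≤ n := by exact_mod_cast le_of_max_le_right hn
  have hn' : (0:ℝ) < n := by exact_mod_cast hn1
  set M := Real.sqrt (288000 * Real.exp 2) with hM
  have hM0 : 0 < M := by positivity
  have hM2 : M ^ 2 = 288000 * Real.exp 2 := Real.sq_sqrt (by positivity)
  have hp := prob_bound X C ε hC hX n m hm2 hm3 M hM0
  refine le_trans ?_ (hp.trans ?_)
  · apply ENNReal.toReal_mono (measure_ne_top _ _)
    apply measure_mono
    intro ω hω
    exact eig_event hn1 (X n ω) (hX.symm n ω) (lam n) (hlam n hn1).1.le M hM0.le m hω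
  · have e1 : (288000 / M ^ 2 : ℝ) = Real.exp (-2) := by
      rw [hM2, Real.exp_neg]; field_simp
    rw [e1, ← Real.exp_nat_mul]
    have e2 : Real.exp (((2 ^ m : ℕ) : ℝ) * -2) ≤ Real.exp (-Real.log n + -Real.log n) := by
      apply Real.exp_le_exp.mpr; linarith
    rw [Real.exp_add, Real.exp_neg, Real.exp_log hn'] at e2
    calc n * Real.exp (((2 ^ m : ℕ) : ℝ) * -2) ≤ n * ((n:ℝ)⁻¹ * (n:ℝ)⁻¹) := by gcongr
      _ = 1 / n := by field_simp
      _ ≤ δ := by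
        rw [div_le_iff₀ hn']
        rw [div_lt_iff₀ hδ] at h2
        nlinarith
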